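/- Let M be exponentially distributed with parameter λ > 0 and let b > 0. Let l* ∈ (2b, 2/λ + 2b) be the unique solution of (c − l)e^{λl} = c + l with c = 2/λ + 2b, and let J^{d,∞} denote the decoder cost of the equilibrium with infinitely many bins whose edges are m_k = k·l*. Then J^{d,∞} = 1/λ² − (l*)²/(e^{λ l*} + e^{−λ l*} − 2), and for every equilibrium with finitely many bins N the decoder cost satisfies J^{d,∞} < J^{d,N}; moreover J^{d,N+1} < J^{d,N} whenever equilibria with N and N+1 bins exist. Hence the equilibrium with infinitely many bins is the most informative one. -/

import Mathlib

open MeasureTheory Set Filter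

/-- Conditional mean `E[M | M ∈ s]` of a random variable with density `f`. -/
noncomputable def condMean (f : ℝ → ℝ) (s : Set ℝ) : ℝ :=
  (∫ x in s, x * f x) / (∫ x in s, f x)

/-- The bin (interval) of real numbers between two extended-real edges `lo` and `hi`. -/
def ebin (lo hi : EReal) : Set ℝ := {x : ℝ | lo ≤ (x : EReal) ∧ (x : EReal) < hi}

/-- Edges `m_0 = m_L < m_1 < ⋯ < m_{N−1} < m_N = +∞` of an `N`-bin quantizer with interior
edges `m : Fin (N−1) → ℝ`, for a source supported on `[m_L, ∞)`. -/
noncomputable def edgesL (mL : ℝ) (N : ℕ) (m : Fin (N - 1) → ℝ) (k : ℕ) : EReal :=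
  if hk : k = 0 then (mL : EReal)
  else if h : k ≤ N - 1 then ((m ⟨k - 1, by omega⟩ : ℝ) : EReal)
  else ⊤

/-- `m : Fin (N−1) → ℝ` is the vector of interior edges of an `N`-bin cheap-talk equilibrium
for a source with density `f` supported on `[m_L, ∞)` and bias `b`: the interior edges are
strictly increasing, lie above `m_L`, and every interior edge `m_k` satisfies the
centroid/nearest-neighbor condition
`m_k = (E[M | m_{k−1} ≤ M < m_k] + E[M | m_k ≤ M < m_{k+1}])/2 + b`. -/
def IsEqL (f : ℝ → ℝ) (mL b : ℝ) (N : ℕ) (m : Fin (N - 1) → ℝ) : Prop :=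
  StrictMono m ∧ (∀ k, mL < m k) ∧ ∀ k : Fin (N - 1),
    m k = (condMean f (ebin (edgesL mL N m k.val) (edgesL mL N m (k.val + 1)))
         + condMean f (ebin (edgesL mL N m (k.val + 1)) (edgesL mL N m (k.val + 2)))) / 2 + b

/-- The exponential density with rate `lam`: `f(x) = λ e^{−λx}` for `x ≥ 0`, `0` otherwise. -/
noncomputable def expPDF (lam : ℝ) (x : ℝ) : ℝ :=
  if 0 ≤ x then lam * Real.exp (-lam * x) else 0

/-- The decoder's cost `J^d = Σ_k ∫_{bin k} (u_k − x)² f(x) dx` of the `N`-bin quantizer of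
`[m_L, ∞)` with interior edges `m`, where `u_k` is the centroid of bin `k`. -/
noncomputable def decoderCostL (f : ℝ → ℝ) (mL : ℝ) (N : ℕ) (m : Fin (N - 1) → ℝ) : ℝ :=
  ∑ k : Fin N, ∫ x in ebin (edgesL mL N m k.val) (edgesL mL N m (k.val + 1)),
    (condMean f (ebin (edgesL mL N m k.val) (edgesL mL N m (k.val + 1))) - x) ^ 2 * f x

/-- The gap `l / (e^{λl} − 1)` between `1/λ` and the mean of an exponential variable conditioned
to `[0, l)`. -/
noncomputable def expGap (lam l : ℝ) : ℝ := l / (Real.exp (lam * l) - 1)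

/-- The gap `l² / (e^{λl} + e^{−λl} − 2)` between `1/λ²` and the variance of an exponential
variable conditioned to an interval of length `l`. -/
noncomputable def expVarGap (lam l : ℝ) : ℝ :=
  l ^ 2 / (Real.exp (lam * l) + Real.exp (-(lam * l)) - 2)

/-- The amount by which the quantizer with finite bins of lengths `L (n-1), …, L 0`, followed by
an unbounded bin, decreases the decoder cost of an exponential source. -/
noncomputable def expGain (lam : ℝ) (L : ℕ → ℝ) : ℕ → ℝ
  | 0 => 0
  | n + 1 => (1 - Real.exp (-(lam * L n))) * expVarGap lam (L n)
      + Real.exp (-(lam * L n)) * expGain lam L n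

lemma expGap_pos {lam l : ℝ} (hlam : 0 < lam) (hl : 0 < l) : 0 < expGap lam l :=
  div_pos hl (sub_pos.2 (Real.one_lt_exp_iff.2 (mul_pos hlam hl)))

lemma expGap_lt_expGap {lam x y : ℝ} (hlam : 0 < lam) (hx : 0 < x) (hxy : x < y) :
    expGap lam y < expGap lam x := by
  have hy := hx.trans hxy
  have h := strictConvexOn_exp.secant_strict_mono (mem_univ 0) (mem_univ (lam * x))
    (mem_univ (lam * y)) (by positivity) (by positivity) (by gcongr)
  have h1 := Real.one_lt_exp_iff.2 (mul_pos hlam hx)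
  have h2 := Real.one_lt_exp_iff.2 (mul_pos hlam hy)
  simp only [Real.exp_zero, sub_zero] at h
  rw [div_lt_div_iff₀ (by positivity) (by positivity)] at h
  rw [expGap, expGap, div_lt_div_iff₀ (by linarith) (by linarith)]
  nlinarith

lemma add_expGap_eq {lam l : ℝ} (hlam : 0 < lam) (hl : 0 < l) :
    l + expGap lam l = l / (1 - Real.exp (-(lam * l))) := by
  have h1 := Real.one_lt_exp_iff.2 (mul_pos hlam hl)
  have h2 : Real.exp (lam * l) - 1 ≠ 0 := by linarith
  rw [expGap, Real.exp_neg]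
  have h3 : 1 - (Real.exp (lam * l))⁻¹ = (Real.exp (lam * l) - 1) / Real.exp (lam * l) := by
    field_simp
  rw [h3, div_div_eq_mul_div, eq_div_iff h2, add_mul, div_mul_cancel₀ _ h2]
  ring

lemma add_expGap_lt_add_expGap {lam x y : ℝ} (hlam : 0 < lam) (hx : 0 < x) (hxy : x < y) :
    x + expGap lam x < y + expGap lam y := by
  have hy := hx.trans hxy
  have hlx := mul_pos hlam hx
  have hly := mul_pos hlam hy
  have h := strictConvexOn_exp.secant_strict_mono (mem_univ 0) (mem_univ (-(lam * y)))
    (mem_univ (-(lam * x))) (by linarith) (by linarith) (neg_lt_neg (by gcongr))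
  have h1 : Real.exp (-(lam * x)) < 1 := Real.exp_lt_one_iff.2 (by linarith)
  have h2 : Real.exp (-(lam * y)) < 1 := Real.exp_lt_one_iff.2 (by linarith)
  simp only [Real.exp_zero, sub_zero] at h
  rw [div_neg, div_neg, neg_lt_neg_iff, div_lt_div_iff₀ (by positivity) (by positivity)] at h
  rw [add_expGap_eq hlam hx, add_expGap_eq hlam hy, div_lt_div_iff₀ (by linarith) (by linarith)]
  nlinarith

lemma lt_of_add_expGap_lt {lam x y : ℝ} (hlam : 0 < lam) (hy : 0 < y)
    (h : x + expGap lam x < y + expGap lam y) : x < y := by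
  rcases lt_trichotomy x y with hxy | rfl | hxy
  · exact hxy
  · exact absurd h (lt_irrefl _)
  · exact absurd h (add_expGap_lt_add_expGap hlam hy hxy).not_gt

lemma eq_of_add_expGap_eq {lam x y : ℝ} (hlam : 0 < lam) (hx : 0 < x) (hy : 0 < y)
    (h : x + expGap lam x = y + expGap lam y) : x = y := by
  rcases lt_trichotomy x y with hxy | hxy | hxy
  · exact absurd h (add_expGap_lt_add_expGap hlam hx hxy).ne
  · exact hxy
  · exact absurd h (add_expGap_lt_add_expGap hlam hy hxy).ne'

lemma expVarGap_eq (lam l : ℝ) :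
    expVarGap lam l = (l / (2 * Real.sinh (lam * l / 2))) ^ 2 := by
  have h1 : Real.exp (lam * l) = Real.exp (lam * l / 2) ^ 2 := by
    rw [← Real.exp_nat_mul]; congr 1; push_cast; ring
  have h2 : Real.exp (-(lam * l)) = Real.exp (-(lam * l / 2)) ^ 2 := by
    rw [← Real.exp_nat_mul]; congr 1; push_cast; ring
  have h3 : Real.exp (lam * l / 2) * Real.exp (-(lam * l / 2)) = 1 := by
    rw [← Real.exp_add, add_neg_cancel, Real.exp_zero]
  rw [expVarGap, div_pow, Real.sinh_eq, h1, h2]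
  congr 1
  linear_combination 2 * h3

lemma strictConvexOn_sinh : StrictConvexOn ℝ (Ici 0) Real.sinh := by
  refine strictConvexOn_of_deriv2_pos (convex_Ici 0) Real.continuous_sinh.continuousOn ?_
  simp

lemma expVarGap_pos {lam l : ℝ} (hlam : 0 < lam) (hl : 0 < l) : 0 < expVarGap lam l := by
  rw [expVarGap_eq]
  have : 0 < Real.sinh (lam * l / 2) := Real.sinh_pos_iff.2 (by positivity)
  positivity

lemma expVarGap_lt_expVarGap {lam x y : ℝ} (hlam : 0 < lam) (hx : 0 < x) (hxy : x < y) :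
    expVarGap lam y < expVarGap lam x := by
  have hy := hx.trans hxy
  have h := strictConvexOn_sinh.secant_strict_mono (a := 0) (x := lam * x / 2) (y := lam * y / 2)
    (by simp) (mem_Ici.2 (by positivity)) (mem_Ici.2 (by positivity)) (by positivity)
    (by positivity) (by gcongr)
  have h1 : 0 < Real.sinh (lam * x / 2) := Real.sinh_pos_iff.2 (by positivity)
  have h2 : 0 < Real.sinh (lam * y / 2) := Real.sinh_pos_iff.2 (by positivity)
  simp only [Real.sinh_zero, sub_zero] at h
  rw [div_lt_div_iff₀ (by positivity) (by positivity)] at h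
  rw [expVarGap_eq, expVarGap_eq]
  refine pow_lt_pow_left₀ ?_ (by positivity) two_ne_zero
  rw [div_lt_div_iff₀ (by positivity) (by positivity)]
  nlinarith

section Integrals

variable {lam : ℝ}

lemma hasDerivAt_quadratic_mul_exp (hlam : 0 < lam) (p q r x : ℝ) :
    HasDerivAt (fun x ↦ -((p * x ^ 2 + q * x + r + (2 * p * x + q) / lam + 2 * p / lam ^ 2)
      * Real.exp (-lam * x))) ((p * x ^ 2 + q * x + r) * (lam * Real.exp (-lam * x))) x := by
  have h1 : HasDerivAt (fun x : ℝ ↦ p * x ^ 2 + q * x + r + (2 * p * x + q) / lam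
      + 2 * p / lam ^ 2) (2 * p * x + q + 2 * p / lam) x := by
    have h := (((((hasDerivAt_pow 2 x).const_mul p).add ((hasDerivAt_id x).const_mul q)).add_const
      r).add ((((hasDerivAt_id x).const_mul (2 * p)).add_const q).div_const lam)).add_const
      (2 * p / lam ^ 2)
    refine h.congr_deriv ?_
    push_cast
    ring
  have h2 : HasDerivAt (fun x : ℝ ↦ Real.exp (-lam * x)) (Real.exp (-lam * x) * -lam) x := by
    simpa using ((hasDerivAt_id x).const_mul (-lam)).exp
  refine (h1.mul h2).neg.congr_deriv ?_
  field_simp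
  ring

lemma setIntegral_Ico_quadratic_mul_expPDF (hlam : 0 < lam) (p q r : ℝ) {a d : ℝ} (ha : 0 ≤ a)
    (had : a ≤ d) :
    ∫ x in Ico a d, (p * x ^ 2 + q * x + r) * expPDF lam x
      = (p * a ^ 2 + q * a + r + (2 * p * a + q) / lam + 2 * p / lam ^ 2) * Real.exp (-lam * a)
      - (p * d ^ 2 + q * d + r + (2 * p * d + q) / lam + 2 * p / lam ^ 2)
        * Real.exp (-lam * d) := by
  have h1 : ∫ x in Ico a d, (p * x ^ 2 + q * x + r) * expPDF lam x
      = ∫ x in Ico a d, (p * x ^ 2 + q * x + r) * (lam * Real.exp (-lam * x)) :=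
    setIntegral_congr_fun measurableSet_Ico fun x hx ↦ by
      simp only [expPDF, if_pos (ha.trans hx.1)]
  rw [h1, integral_Ico_eq_integral_Ioc, ← intervalIntegral.integral_of_le had,
    intervalIntegral.integral_eq_sub_of_hasDerivAt
      (fun x _ ↦ hasDerivAt_quadratic_mul_exp hlam p q r x)
      (Continuous.intervalIntegrable (by fun_prop) _ _)]
  ring

lemma tendsto_quadratic_mul_exp (hlam : 0 < lam) (p q r : ℝ) :
    Tendsto (fun x ↦ (p * x ^ 2 + q * x + r) * Real.exp (-lam * x)) atTop (nhds 0) := by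
  have h (n : ℕ) : Tendsto (fun x : ℝ ↦ x ^ n * Real.exp (-lam * x)) atTop (nhds 0) := by
    have := tendsto_rpow_mul_exp_neg_mul_atTop_nhds_zero n lam hlam
    simpa using this
  have := (((h 2).const_mul p).add ((h 1).const_mul q)).add ((h 0).const_mul r)
  simp only [mul_zero, add_zero] at this
  refine this.congr fun x ↦ ?_
  ring

lemma setIntegral_Ici_quadratic_mul_expPDF (hlam : 0 < lam) (p q r : ℝ) {a : ℝ} (ha : 0 ≤ a)
    (hnn : ∀ x, 0 ≤ x → 0 ≤ p * x ^ 2 + q * x + r) :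
    ∫ x in Ici a, (p * x ^ 2 + q * x + r) * expPDF lam x
      = (p * a ^ 2 + q * a + r + (2 * p * a + q) / lam + 2 * p / lam ^ 2)
        * Real.exp (-lam * a) := by
  have h1 : ∫ x in Ici a, (p * x ^ 2 + q * x + r) * expPDF lam x
      = ∫ x in Ici a, (p * x ^ 2 + q * x + r) * (lam * Real.exp (-lam * x)) :=
    setIntegral_congr_fun measurableSet_Ici fun x hx ↦ by
      simp only [expPDF, if_pos (ha.trans hx)]
  have h2 : Tendsto (fun x ↦ -((p * x ^ 2 + q * x + r + (2 * p * x + q) / lam + 2 * p / lam ^ 2)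
      * Real.exp (-lam * x))) atTop (nhds 0) := by
    have := (tendsto_quadratic_mul_exp hlam p (q + 2 * p / lam)
      (r + q / lam + 2 * p / lam ^ 2)).neg
    rw [neg_zero] at this
    refine this.congr fun x ↦ ?_
    ring
  rw [h1, integral_Ici_eq_integral_Ioi, integral_Ioi_of_hasDerivAt_of_nonneg'
    (fun x _ ↦ hasDerivAt_quadratic_mul_exp hlam p q r x)
    (fun x hx ↦ mul_nonneg (hnn x (ha.trans (le_of_lt hx))) (by positivity)) h2]
  ring

lemma condMean_expPDF_Ico (hlam : 0 < lam) {a d : ℝ} (ha : 0 ≤ a) (had : a < d) :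
    condMean (expPDF lam) (Ico a d) = a + 1 / lam - expGap lam (d - a) := by
  have h1 := setIntegral_Ico_quadratic_mul_expPDF hlam 0 1 0 ha had.le
  have h0 := setIntegral_Ico_quadratic_mul_expPDF hlam 0 0 1 ha had.le
  have he := Real.one_lt_exp_iff.2 (mul_pos hlam (sub_pos.2 had))
  have hd : Real.exp (-lam * a) = Real.exp (-lam * d) * Real.exp (lam * (d - a)) := by
    rw [← Real.exp_add]; congr 1; ring
  simp only [zero_mul, one_mul, zero_add, add_zero, mul_zero, zero_div] at h1 h0
  have hE := Real.exp_pos (-lam * d)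
  rw [condMean, h1, h0, hd, expGap]
  generalize Real.exp (lam * (d - a)) = E at *
  have hE1 : E - 1 ≠ 0 := by linarith
  have hE2 : Real.exp (-lam * d) * E - Real.exp (-lam * d) = Real.exp (-lam * d) * (E - 1) := by
    ring
  rw [hE2]
  field_simp
  ring

lemma condMean_expPDF_Ici (hlam : 0 < lam) {a : ℝ} (ha : 0 ≤ a) :
    condMean (expPDF lam) (Ici a) = a + 1 / lam := by
  have h1 := setIntegral_Ici_quadratic_mul_expPDF hlam 0 1 0 ha (by intro x hx; simpa)
  have h0 := setIntegral_Ici_quadratic_mul_expPDF hlam 0 0 1 ha (by intro x hx; simp)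
  simp only [zero_mul, one_mul, zero_add, add_zero, mul_zero, zero_div] at h1 h0
  rw [condMean, h1, h0]
  field_simp

lemma binCost_expPDF_Ico (hlam : 0 < lam) {a d : ℝ} (ha : 0 ≤ a) (had : a < d) :
    ∫ x in Ico a d, (condMean (expPDF lam) (Ico a d) - x) ^ 2 * expPDF lam x
      = (Real.exp (-(lam * a)) - Real.exp (-(lam * d)))
        * (1 / lam ^ 2 - expVarGap lam (d - a)) := by
  rw [condMean_expPDF_Ico hlam ha had]
  set u := a + 1 / lam - expGap lam (d - a) with hu
  have h := setIntegral_Ico_quadratic_mul_expPDF hlam 1 (-2 * u) (u ^ 2) ha had.le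
  have h' : ∫ x in Ico a d, (u - x) ^ 2 * expPDF lam x
      = ∫ x in Ico a d, (1 * x ^ 2 + -2 * u * x + u ^ 2) * expPDF lam x := by
    congr 1; ext x; ring
  have he := Real.one_lt_exp_iff.2 (mul_pos hlam (sub_pos.2 had))
  have hd : Real.exp (-(lam * a)) = Real.exp (-(lam * d)) * Real.exp (lam * (d - a)) := by
    rw [← Real.exp_add]; congr 1; ring
  rw [h', h, neg_mul lam a, neg_mul lam d, hd, hu, expVarGap, expGap, Real.exp_neg (lam * (d - a))]
  generalize Real.exp (lam * (d - a)) = E at *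
  have hE1 : E - 1 ≠ 0 := by linarith
  have hE0 : E ≠ 0 := by linarith
  have hE2 : E + E⁻¹ - 2 = (E - 1) ^ 2 / E := by field_simp; ring
  rw [hE2]
  field_simp
  ring

lemma binCost_expPDF_Ici (hlam : 0 < lam) {a : ℝ} (ha : 0 ≤ a) :
    ∫ x in Ici a, (condMean (expPDF lam) (Ici a) - x) ^ 2 * expPDF lam x
      = Real.exp (-(lam * a)) * (1 / lam ^ 2) := by
  rw [condMean_expPDF_Ici hlam ha]
  set u := a + 1 / lam with hu
  have h := setIntegral_Ici_quadratic_mul_expPDF hlam 1 (-2 * u) (u ^ 2) ha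
    (fun x _ ↦ by nlinarith [sq_nonneg (x - u)])
  have h' : ∫ x in Ici a, (u - x) ^ 2 * expPDF lam x
      = ∫ x in Ici a, (1 * x ^ 2 + -2 * u * x + u ^ 2) * expPDF lam x := by
    congr 1; ext x; ring
  rw [h', h, neg_mul lam a, hu]
  field_simp
  ring

lemma tsum_binCost_expPDF (hlam : 0 < lam) {l : ℝ} (hl : 0 < l) :
    ∑' k : ℕ, ∫ x in Ico ((k : ℝ) * l) (((k : ℝ) + 1) * l),
      (condMean (expPDF lam) (Ico ((k : ℝ) * l) (((k : ℝ) + 1) * l)) - x) ^ 2 * expPDF lam x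
      = 1 / lam ^ 2 - expVarGap lam l := by
  have hr : Real.exp (-(lam * l)) < 1 := Real.exp_lt_one_iff.2 (by nlinarith)
  have h (k : ℕ) : ∫ x in Ico ((k : ℝ) * l) (((k : ℝ) + 1) * l),
      (condMean (expPDF lam) (Ico ((k : ℝ) * l) (((k : ℝ) + 1) * l)) - x) ^ 2 * expPDF lam x
      = Real.exp (-(lam * l)) ^ k
        * ((1 - Real.exp (-(lam * l))) * (1 / lam ^ 2 - expVarGap lam l)) := by
    rw [binCost_expPDF_Ico hlam (by positivity) (by linarith)]
    have h1 : Real.exp (-(lam * (k * l))) = Real.exp (-(lam * l)) ^ k := by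
      rw [← Real.exp_nat_mul]; congr 1; ring
    have h2 : Real.exp (-(lam * ((k + 1) * l)))
        = Real.exp (-(lam * l)) ^ k * Real.exp (-(lam * l)) := by
      rw [← h1, ← Real.exp_add]; congr 1; ring
    have h3 : ((k : ℝ) + 1) * l - k * l = l := by ring
    rw [h1, h2, h3]
    ring
  have hne : 1 - Real.exp (-(lam * l)) ≠ 0 := by linarith
  simp_rw [h]
  rw [tsum_mul_right, tsum_geometric_of_lt_one (Real.exp_pos _).le hr, inv_mul_cancel_left₀ hne]

end Integrals

lemma ebin_coe_coe (a d : ℝ) : ebin a d = Ico a d := by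
  ext x; simp [ebin]

lemma ebin_coe_top (a : ℝ) : ebin a ⊤ = Ici a := by
  ext x; simp [ebin]

lemma expGain_congr {lam : ℝ} {L L' : ℕ → ℝ} {n : ℕ} (h : ∀ j < n, L j = L' j) :
    expGain lam L n = expGain lam L' n := by
  induction n with
  | zero => rfl
  | succ n ih =>
    rw [expGain, expGain, h n n.lt_succ_self, ih fun j hj ↦ h j (hj.trans n.lt_succ_self)]

lemma sum_mul_expVarGap_eq_expGain (lam : ℝ) (a : ℕ → ℝ) (n : ℕ) :
    ∑ k ∈ Finset.range n, (Real.exp (-(lam * a k)) - Real.exp (-(lam * a (k + 1))))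
        * expVarGap lam (a (k + 1) - a k)
      = Real.exp (-(lam * a 0)) * expGain lam (fun j ↦ a (n - j) - a (n - (j + 1))) n := by
  induction n generalizing a with
  | zero => simp [expGain]
  | succ n ih =>
    have hc : expGain lam (fun j ↦ a (n - j + 1) - a (n - (j + 1) + 1)) n
        = expGain lam (fun j ↦ a (n + 1 - j) - a (n + 1 - (j + 1))) n := by
      refine expGain_congr fun j hj ↦ ?_
      rw [show n - j + 1 = n + 1 - j by omega,
        show n - (j + 1) + 1 = n + 1 - (j + 1) by omega]
    have he : Real.exp (-(lam * a 1))
        = Real.exp (-(lam * a 0)) * Real.exp (-(lam * (a 1 - a 0))) := by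
      rw [← Real.exp_add]; congr 1; ring
    rw [Finset.sum_range_succ', ih fun k ↦ a (k + 1), expGain, hc]
    simp only [add_tsub_cancel_left, tsub_self, zero_add, he]
    ring

/-- The bin lengths of an equilibrium, indexed from the last finite bin downwards, satisfy a
recursion that does not depend on the number of bins. -/
structure IsEqLengths (lam c : ℝ) (n : ℕ) (L : ℕ → ℝ) : Prop where
  pos : ∀ j < n, 0 < L j
  zero : 0 < n → L 0 + expGap lam (L 0) = c
  succ : ∀ j, j + 1 < n → L (j + 1) + expGap lam (L (j + 1)) + expGap lam (L j) = c

namespace IsEqLengths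

variable {lam c : ℝ} {n : ℕ} {L : ℕ → ℝ}

lemma mono {k : ℕ} (h : IsEqLengths lam c n L) (hk : k ≤ n) : IsEqLengths lam c k L where
  pos j hj := h.pos j (hj.trans_le hk)
  zero h0 := h.zero (h0.trans_le hk)
  succ j hj := h.succ j (hj.trans_le hk)

lemma unique {L' : ℕ → ℝ} (hlam : 0 < lam) (h : IsEqLengths lam c n L)
    (h' : IsEqLengths lam c n L') : ∀ j < n, L j = L' j := by
  intro j
  induction j with
  | zero =>
    intro hj
    exact eq_of_add_expGap_eq hlam (h.pos 0 hj) (h'.pos 0 hj) ((h.zero hj).trans (h'.zero hj).symm)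
  | succ j ih =>
    intro hj
    have h1 := h.succ j hj
    have h2 := h'.succ j hj
    rw [ih (by omega)] at h1
    exact eq_of_add_expGap_eq hlam (h.pos _ hj) (h'.pos _ hj) (by linarith)

lemma succ_lt (hlam : 0 < lam) (h : IsEqLengths lam c n L) :
    ∀ j, j + 1 < n → L (j + 1) < L j := by
  intro j
  induction j with
  | zero =>
    intro hj
    have h0 := h.pos 0 (by omega)
    have := expGap_pos hlam h0
    exact lt_of_add_expGap_lt hlam h0
      (by linarith [h.zero (by omega), h.succ 0 hj])
  | succ j ih =>
    intro hj
    have h1 := h.pos (j + 1) (by omega)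
    have := expGap_lt_expGap hlam h1 (ih (by omega))
    exact lt_of_add_expGap_lt hlam h1
      (by linarith [h.succ j (by omega), h.succ (j + 1) hj])

lemma fixedPoint_lt {l : ℝ} (hlam : 0 < lam) (hl : 0 < l) (hfix : l + 2 * expGap lam l = c)
    (h : IsEqLengths lam c n L) : ∀ j < n, l < L j := by
  intro j
  induction j with
  | zero =>
    intro hj
    have := expGap_pos hlam hl
    exact lt_of_add_expGap_lt hlam (h.pos 0 hj) (by linarith [h.zero hj])
  | succ j ih =>
    intro hj
    have := expGap_lt_expGap hlam hl (ih (by omega))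
    exact lt_of_add_expGap_lt hlam (h.pos _ hj) (by linarith [h.succ j hj])

lemma expGain_lt_expVarGap (hlam : 0 < lam) (h : IsEqLengths lam c n L) :
    ∀ j < n, expGain lam L j < expVarGap lam (L j) := by
  intro j
  induction j with
  | zero => exact fun hj ↦ expVarGap_pos hlam (h.pos 0 hj)
  | succ j ih =>
    intro hj
    have h1 := ih (by omega)
    have h2 := expVarGap_lt_expVarGap hlam (h.pos _ hj) (h.succ_lt hlam j hj)
    have h3 := Real.exp_pos (-(lam * L j))
    rw [expGain]
    nlinarith

lemma expGain_lt_expGain_succ (hlam : 0 < lam) (h : IsEqLengths lam c (n + 1) L) :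
    expGain lam L n < expGain lam L (n + 1) := by
  have h0 := h.pos n n.lt_succ_self
  have h1 := h.expGain_lt_expVarGap hlam n n.lt_succ_self
  have h2 : Real.exp (-(lam * L n)) < 1 := Real.exp_lt_one_iff.2 (by nlinarith)
  rw [expGain]
  nlinarith

lemma expGain_lt_fixedPoint {l : ℝ} (hlam : 0 < lam) (hl : 0 < l)
    (hfix : l + 2 * expGap lam l = c) (h : IsEqLengths lam c n L) :
    expGain lam L n < expVarGap lam l := by
  induction n with
  | zero => exact expVarGap_pos hlam hl
  | succ n ih =>
    have h0 := h.pos n n.lt_succ_self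
    have h1 := ih (h.mono n.le_succ)
    have h2 := expVarGap_lt_expVarGap hlam hl (h.fixedPoint_lt hlam hl hfix n n.lt_succ_self)
    have h3 := Real.exp_pos (-(lam * L n))
    have h4 : Real.exp (-(lam * L n)) < 1 := Real.exp_lt_one_iff.2 (by nlinarith)
    rw [expGain]
    nlinarith

end IsEqLengths

lemma edgesL_eq_coe_or_top (mL : ℝ) (n : ℕ) (m : Fin (n + 1 - 1) → ℝ) :
    ∃ a : ℕ → ℝ, a 0 = mL ∧ (∀ k : Fin (n + 1 - 1), a (k.val + 1) = m k) ∧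
      (∀ k ≤ n, edgesL mL (n + 1) m k = a k) ∧ ∀ k, n < k → edgesL mL (n + 1) m k = ⊤ := by
  refine ⟨fun k ↦ (edgesL mL (n + 1) m k).toReal, ?_, ?_, ?_, ?_⟩
  · simp [edgesL]
  · rintro ⟨k, hk⟩
    have hk' : k + 1 ≤ n := by omega
    simp [edgesL, hk']
  · intro k hk
    rcases k with _ | k
    · simp [edgesL]
    · simp [edgesL, hk]
  · intro k hk
    have h1 : k ≠ 0 := by omega
    simp [edgesL, h1, hk]

lemma IsEqL.exists_isEqLengths {lam b : ℝ} (hlam : 0 < lam) {n : ℕ} {m : Fin (n + 1 - 1) → ℝ}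
    (h : IsEqL (expPDF lam) 0 b (n + 1) m) :
    ∃ L, IsEqLengths lam (2 / lam + 2 * b) n L ∧
      decoderCostL (expPDF lam) 0 (n + 1) m = 1 / lam ^ 2 - expGain lam L n := by
  obtain ⟨hmono, hpos, heq⟩ := h
  obtain ⟨a, ha0, ham, hle, htop⟩ := edgesL_eq_coe_or_top 0 n m
  have hnn : ∀ k ≤ n, 0 ≤ a k := by
    rintro (_ | k) hk
    · exact ha0.ge
    · exact (ham ⟨k, hk⟩).symm ▸ (hpos _).le
  have hlt : ∀ k < n, a k < a (k + 1) := by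
    rintro (_ | k) hk
    · rw [ha0]
      exact (ham ⟨0, hk⟩).symm ▸ hpos _
    · have h1 := ham ⟨k, by omega⟩
      have h2 := ham ⟨k + 1, hk⟩
      simp only at h1 h2
      rw [h1, h2]
      exact hmono (by simp)
  have hbin : ∀ k < n, ebin (edgesL 0 (n + 1) m k) (edgesL 0 (n + 1) m (k + 1))
      = Ico (a k) (a (k + 1)) := fun k hk ↦ by
    rw [hle k hk.le, hle (k + 1) hk, ebin_coe_coe]
  have hlast : ebin (edgesL 0 (n + 1) m n) (edgesL 0 (n + 1) m (n + 1)) = Ici (a n) := by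
    rw [hle n le_rfl, htop (n + 1) n.lt_succ_self, ebin_coe_top]
  have hmean : ∀ k < n,
      condMean (expPDF lam) (ebin (edgesL 0 (n + 1) m k) (edgesL 0 (n + 1) m (k + 1)))
        = a k + 1 / lam - expGap lam (a (k + 1) - a k) := fun k hk ↦ by
    rw [hbin k hk, condMean_expPDF_Ico hlam (hnn k hk.le) (hlt k hk)]
  have hc : 2 / lam = 1 / lam + 1 / lam := by ring
  refine ⟨fun j ↦ a (n - j) - a (n - (j + 1)), ⟨?_, ?_, ?_⟩, ?_⟩
  · intro j hj
    have := hlt (n - (j + 1)) (by omega)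
    rw [show n - (j + 1) + 1 = n - j by omega] at this
    exact sub_pos.2 this
  · intro hn
    obtain ⟨k, rfl⟩ : ∃ k, n = k + 1 := ⟨n - 1, by omega⟩
    have h1 := heq ⟨k, by omega⟩
    have h2 := ham ⟨k, by omega⟩
    simp only at h1 h2
    rw [hmean k (by omega), hlast, condMean_expPDF_Ici hlam (hnn _ le_rfl), ← h2] at h1
    simp only [tsub_zero, zero_add, add_tsub_cancel_right]
    linarith
  · intro j hj
    obtain ⟨k, rfl⟩ : ∃ k, n = k + j + 2 := ⟨n - j - 2, by omega⟩
    have h1 := heq ⟨k, by omega⟩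
    have h2 := ham ⟨k, by omega⟩
    simp only at h1 h2
    rw [hmean k (by omega), hmean (k + 1) (by omega), ← h2] at h1
    simp only [show k + j + 2 - j = k + 1 + 1 by omega,
      show k + j + 2 - (j + 1) = k + 1 by omega, show k + j + 2 - (j + 1 + 1) = k by omega]
    linarith
  · have hsum := sum_mul_expVarGap_eq_expGain lam a n
    rw [ha0, mul_zero, neg_zero, Real.exp_zero, one_mul] at hsum
    have htel := Finset.sum_range_sub' (fun k ↦ Real.exp (-(lam * a k))) n
    simp only [ha0, mul_zero, neg_zero, Real.exp_zero] at htel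
    rw [← hsum, decoderCostL, Fin.sum_univ_eq_sum_range (fun k ↦
      ∫ x in ebin (edgesL 0 (n + 1) m k) (edgesL 0 (n + 1) m (k + 1)),
        (condMean (expPDF lam) (ebin (edgesL 0 (n + 1) m k) (edgesL 0 (n + 1) m (k + 1))) - x) ^ 2
          * expPDF lam x) (n + 1), Finset.sum_range_succ, hlast,
      binCost_expPDF_Ici hlam (hnn n le_rfl)]
    have hcost : ∀ k ∈ Finset.range n,
        ∫ x in ebin (edgesL 0 (n + 1) m k) (edgesL 0 (n + 1) m (k + 1)),
          (condMean (expPDF lam) (ebin (edgesL 0 (n + 1) m k) (edgesL 0 (n + 1) m (k + 1))) - x)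
            ^ 2 * expPDF lam x
        = (Real.exp (-(lam * a k)) - Real.exp (-(lam * a (k + 1)))) * (1 / lam ^ 2)
          - (Real.exp (-(lam * a k)) - Real.exp (-(lam * a (k + 1))))
            * expVarGap lam (a (k + 1) - a k) := fun k hk ↦ by
      have hk := Finset.mem_range.1 hk
      rw [hbin k hk, binCost_expPDF_Ico hlam (hnn k hk.le) (hlt k hk), mul_sub]
    rw [Finset.sum_congr rfl hcost, Finset.sum_sub_distrib, ← Finset.sum_mul, htel]
    ring

/-- For an exponential source with parameter `λ > 0` and bias `b > 0`, let
`l*` be the unique solution in `(2b, 2/λ + 2b)` of `(c − l)e^{λl} = c + l`, `c = 2/λ + 2b`,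
and let `J^{d,∞}` be the decoder cost of the infinite-bin equilibrium with edges `m_k = k·l*`.
Then `J^{d,∞} = 1/λ² − (l*)²/(e^{λl*} + e^{−λl*} − 2)`, the cost of every finite-bin
equilibrium is strictly larger than `J^{d,∞}`, and `J^{d,N+1} < J^{d,N}` whenever equilibria
with `N` and `N+1` bins exist: the infinite-bin equilibrium is the most informative one. -/
theorem exp_infinite_most_informative (lam b : ℝ) (hlam : 0 < lam) (hb : 0 < b)
    (l : ℝ) (hl1 : 2 * b < l) (hl2 : l < 2 / lam + 2 * b)
    (hl3 : ((2 / lam + 2 * b) - l) * Real.exp (lam * l) = (2 / lam + 2 * b) + l)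
    (Jinf : ℝ)
    (hJinf : Jinf = ∑' k : ℕ, ∫ x in Ico ((k : ℝ) * l) (((k : ℝ) + 1) * l),
      (condMean (expPDF lam) (Ico ((k : ℝ) * l) (((k : ℝ) + 1) * l)) - x) ^ 2
        * expPDF lam x) :
    Jinf = 1 / lam ^ 2 - l ^ 2 / (Real.exp (lam * l) + Real.exp (-(lam * l)) - 2) ∧
    (∀ (N : ℕ) (m : Fin (N - 1) → ℝ), 1 ≤ N → IsEqL (expPDF lam) 0 b N m →
      Jinf < decoderCostL (expPDF lam) 0 N m) ∧
    (∀ (N : ℕ) (mN : Fin (N - 1) → ℝ) (mN1 : Fin (N + 1 - 1) → ℝ), 1 ≤ N →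
      IsEqL (expPDF lam) 0 b N mN → IsEqL (expPDF lam) 0 b (N + 1) mN1 →
      decoderCostL (expPDF lam) 0 (N + 1) mN1 < decoderCostL (expPDF lam) 0 N mN) := by
  have hl : 0 < l := by linarith
  have he := Real.one_lt_exp_iff.2 (mul_pos hlam hl)
  have hfix : l + 2 * expGap lam l = 2 / lam + 2 * b := by
    have hne : Real.exp (lam * l) - 1 ≠ 0 := by linarith
    rw [expGap, mul_div_assoc', ← eq_sub_iff_add_eq', div_eq_iff hne]
    linarith
  rw [tsum_binCost_expPDF hlam hl] at hJinf
  refine ⟨hJinf, ?_, ?_⟩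
  · intro N m hN h
    obtain ⟨n, rfl⟩ := Nat.exists_eq_add_of_le' hN
    obtain ⟨L, hL, hcost⟩ := h.exists_isEqLengths hlam
    rw [hJinf, hcost]
    linarith [hL.expGain_lt_fixedPoint hlam hl hfix]
  · intro N mN mN1 hN h h'
    obtain ⟨n, rfl⟩ := Nat.exists_eq_add_of_le' hN
    obtain ⟨L, hL, hcost⟩ := h.exists_isEqLengths hlam
    obtain ⟨L', hL', hcost'⟩ := h'.exists_isEqLengths hlam
    rw [hcost, hcost', expGain_congr (hL.unique hlam (hL'.mono n.le_succ))]
    linarith [hL'.expGain_lt_expGain_succ hlam]
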